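/- Let S, H, D : ℝ → ℝ with D(x) ≠ 0 for all x, S differentiable, H differentiable, the function u(x) = H'(x)/D(x) differentiable, and D twice differentiable. Then the following ten expressions are all constant functions of x — E1 = S' − u', E2 = −(S/4)(S/3 − u) + (1/6)(D''/D − u²), E3 = S', E4 = −(S/4)(S − u), E5 = (S/4)(S/2 − u) + u²/8, E6 = (S/4)(S/4 − u) + (1/4)((3/4)u² − D''/D), E7 = (S/4)(S − u), E8 = S, E9 = −S²/48 − (1/12)(D''/D − u²/4), E10 = (S/16)(S − u) — if and only if S, H'/D and D''/D are each constant. -/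

import Mathlib

/-- A differentiable real function with constant square is constant. -/
theorem exists_const_of_sq_eq_const {f : ℝ → ℝ} (hf : Differentiable ℝ f) {k : ℝ}
    (h : ∀ x, f x ^ 2 = k) : ∃ c, ∀ x, f x = c := by
  refine ⟨f 0, fun x => is_const_of_deriv_eq_zero hf (fun y => ?_) x 0⟩
  have h1 : HasDerivAt (fun x => f x ^ 2) (2 * f y * deriv f y) y := by
    simpa using (hf y).hasDerivAt.fun_pow 2
  have h2 : 2 * f y * deriv f y = 0 := by
    rw [funext h] at h1
    exact h1.unique (hasDerivAt_const y k)
  rcases mul_eq_zero.mp h2 with h3 | h3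
  · have hk : k = 0 := by
      rw [← h y, show f y = 0 by linarith]
      norm_num
    have hf0 : f = fun _ => 0 := funext fun z => pow_eq_zero_iff two_ne_zero |>.mp ((h z).trans hk)
    simp [hf0]
  · exact h3


/-- Cartan-scalar constancy characterization of space-time homogeneity for
Riemann-Cartan Gödel-type space-times: the ten zeroth-order Cartan scalar
expressions `E1 … E10` built from `S`, `u = H'/D` and `v = D''/D` are all
constant iff `S`, `H'/D` and `D''/D` are each constant. -/
theorem godel_type_homogeneity_iff
    (S H D : ℝ → ℝ)
    (hD0 : ∀ x, D x ≠ 0)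
    (hS : Differentiable ℝ S)
    (hH : Differentiable ℝ H)
    (hu : Differentiable ℝ (fun x => deriv H x / D x))
    (hD : Differentiable ℝ D)
    (hD' : Differentiable ℝ (deriv D)) :
    ((∃ c, ∀ x, deriv S x - deriv (fun y => deriv H y / D y) x = c) ∧
     (∃ c, ∀ x, -(S x / 4) * (S x / 3 - deriv H x / D x)
        + (1 / 6) * (deriv (deriv D) x / D x - (deriv H x / D x) ^ 2) = c) ∧
     (∃ c, ∀ x, deriv S x = c) ∧
     (∃ c, ∀ x, -(S x / 4) * (S x - deriv H x / D x) = c) ∧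
     (∃ c, ∀ x, (S x / 4) * (S x / 2 - deriv H x / D x)
        + (deriv H x / D x) ^ 2 / 8 = c) ∧
     (∃ c, ∀ x, (S x / 4) * (S x / 4 - deriv H x / D x)
        + (1 / 4) * ((3 / 4) * (deriv H x / D x) ^ 2 - deriv (deriv D) x / D x) = c) ∧
     (∃ c, ∀ x, (S x / 4) * (S x - deriv H x / D x) = c) ∧
     (∃ c, ∀ x, S x = c) ∧
     (∃ c, ∀ x, -(S x) ^ 2 / 48
        - (1 / 12) * (deriv (deriv D) x / D x - (deriv H x / D x) ^ 2 / 4) = c) ∧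
     (∃ c, ∀ x, (S x / 16) * (S x - deriv H x / D x) = c)) ↔
    ((∃ c, ∀ x, S x = c) ∧
     (∃ c, ∀ x, deriv H x / D x = c) ∧
     (∃ c, ∀ x, deriv (deriv D) x / D x = c)) := by
  constructor
  · rintro ⟨-, -, -, -, ⟨c₅, h₅⟩, -, ⟨c₇, h₇⟩, ⟨s, hs⟩, ⟨c₉, h₉⟩, -⟩
    obtain ⟨a, ha⟩ : ∃ a, ∀ x, deriv H x / D x = a := by
      refine exists_const_of_sq_eq_const hu (k := 8 * (c₅ - c₇ + s ^ 2 / 8)) fun x => ?_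
      have h5 := h₅ x
      have h7 := h₇ x
      rw [hs x] at h5 h7
      linear_combination 8 * h5 - 8 * h7
    refine ⟨⟨s, hs⟩, ⟨a, ha⟩, -12 * c₉ - s ^ 2 / 4 + a ^ 2 / 4, fun x => ?_⟩
    have h9 := h₉ x
    rw [hs x, ha x] at h9
    linear_combination -12 * h9
  · rintro ⟨⟨s, hs⟩, ⟨a, ha⟩, ⟨b, hb⟩⟩
    have hS' : ∀ x, deriv S x = 0 := fun x => by simp [funext hs]
    simp only [hS', hs, ha, hb, deriv_const]
    exact ⟨⟨_, fun _ => rfl⟩, ⟨_, fun _ => rfl⟩, ⟨_, fun _ => rfl⟩, ⟨_, fun _ => rfl⟩,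
      ⟨_, fun _ => rfl⟩, ⟨_, fun _ => rfl⟩, ⟨_, fun _ => rfl⟩, ⟨_, fun _ => rfl⟩,
      ⟨_, fun _ => rfl⟩, ⟨_, fun _ => rfl⟩⟩
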